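/- (Cellwise L² stability of the OE procedure.) For every u ∈ V^k, all nonnegative cell wave speeds β_j, every cell I_j, and all 0 ≤ t̂₁ ≤ t̂₂, the solution of the damping initial value problem satisfies ‖u_σ(·, t̂₂)‖_{L²(I_j)} ≤ ‖u_σ(·, t̂₁)‖_{L²(I_j)}. In particular, ‖F_τ u‖_{L²(I_j)} ≤ ‖u‖_{L²(I_j)} for every cell I_j, so the OE procedure does not increase the element-wise L² norm of the numerical solution. -/

import Mathlib

open Polynomial Finset MeasureTheory

namespace OEDG

variable {N : ℕ}

/-- `pt` lists the nodes `x_{1/2} < x_{3/2} < … < x_{N+1/2}` of a partition of `Ω = [0,1]`. -/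
def IsMesh (pt : Fin (N+1) → ℝ) : Prop :=
  pt 0 = 0 ∧ pt (Fin.last N) = 1 ∧ StrictMono pt

/-- Left endpoint of cell `j`. -/
def ptL (pt : Fin (N+1) → ℝ) (j : Fin N) : ℝ := pt j.castSucc

/-- Right endpoint of cell `j`. -/
def ptR (pt : Fin (N+1) → ℝ) (j : Fin N) : ℝ := pt j.succ

/-- Length `h_j` of cell `j`. -/
def cellh (pt : Fin (N+1) → ℝ) (j : Fin N) : ℝ := ptR pt j - ptL pt j

/-- Maximal mesh size `h`. -/
noncomputable def meshSize (pt : Fin (N+1) → ℝ) : ℝ := ⨆ j : Fin N, cellh pt j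

/-- Quasi-uniformity of the partition: `h ≤ γ h_j` for all `j`. -/
def QuasiUniform (pt : Fin (N+1) → ℝ) (γ : ℝ) : Prop :=
  ∀ j : Fin N, meshSize pt ≤ γ * cellh pt j

/-- Membership in `V^k`: every cell polynomial has degree at most `k`. -/
def MemVk (k : ℕ) (u : Fin N → Polynomial ℝ) : Prop :=
  ∀ j, (u j).natDegree ≤ k

/-- Cellwise `L²` inner product. -/
noncomputable def cip (pt : Fin (N+1) → ℝ) (j : Fin N) (p q : Polynomial ℝ) : ℝ :=
  ∫ x in (ptL pt j)..(ptR pt j), p.eval x * q.eval x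

/-- Global `L²(Ω)` inner product of piecewise polynomials. -/
noncomputable def ip (pt : Fin (N+1) → ℝ) (u v : Fin N → Polynomial ℝ) : ℝ :=
  ∑ j : Fin N, cip pt j (u j) (v j)

/-- Cellwise `L²` norm. -/
noncomputable def cl2 (pt : Fin (N+1) → ℝ) (j : Fin N) (p : Polynomial ℝ) : ℝ :=
  Real.sqrt (cip pt j p p)

/-- Global `L²(Ω)` norm of a piecewise polynomial. -/
noncomputable def l2 (pt : Fin (N+1) → ℝ) (u : Fin N → Polynomial ℝ) : ℝ :=
  Real.sqrt (ip pt u u)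

/-- Average `avg(u) = (1/|Ω|) ∫_Ω u dx` (here `|Ω| = 1`). -/
noncomputable def avg (pt : Fin (N+1) → ℝ) (u : Fin N → Polynomial ℝ) : ℝ :=
  ∑ j : Fin N, ∫ x in (ptL pt j)..(ptR pt j), (u j).eval x

/-- `‖u - c‖_{L∞(Ω)}` for a piecewise polynomial `u` and a constant `c`. -/
noncomputable def linfSub (pt : Fin (N+1) → ℝ) (u : Fin N → Polynomial ℝ) (c : ℝ) : ℝ :=
  ⨆ j : Fin N, sSup ((fun x => |(u j).eval x - c|) '' Set.Icc (ptL pt j) (ptR pt j))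

/-- `m`-th derivative of a polynomial. -/
noncomputable def pderiv (m : ℕ) (p : Polynomial ℝ) : Polynomial ℝ :=
  (fun q : Polynomial ℝ => Polynomial.derivative q)^[m] p

/-- Jump `[∂_x^m u]_{j+1/2}` of the `m`-th derivative at the interface to the right of
cell `j`, with periodic identification of `x_{N+1/2}` with `x_{1/2}`. -/
noncomputable def jumpD [NeZero N] (pt : Fin (N+1) → ℝ) (u : Fin N → Polynomial ℝ)
    (m : ℕ) (j : Fin N) : ℝ :=
  (pderiv m (u (j+1))).eval (pt (Fin.castSucc (j+1))) - (pderiv m (u j)).eval (pt j.succ)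

/-- The scale-invariant damping coefficient `σ_j^m(u)` of the OEDG method. -/
noncomputable def sigma [NeZero N] (k : ℕ) (pt : Fin (N+1) → ℝ)
    (u : Fin N → Polynomial ℝ) (m : ℕ) (j : Fin N) : ℝ :=
  if ∀ i, u i = Polynomial.C (avg pt u) then 0
  else (2*(m:ℝ)+1) * (cellh pt j)^m / ((2*(k:ℝ)-1) * (Nat.factorial m)) *
    ((|jumpD pt u m (j-1)| + |jumpD pt u m j|) / (2 * linfSub pt u (avg pt u)))

/-- Damping rate `δ_j^m = β_j σ_j^m(u) / h_j`. -/
noncomputable def dampRate [NeZero N] (k : ℕ) (pt : Fin (N+1) → ℝ) (β : Fin N → ℝ)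
    (u : Fin N → Polynomial ℝ) (m : ℕ) (j : Fin N) : ℝ :=
  β j * sigma k pt u m j / cellh pt j

/-- `Pc j d` is the cellwise `L²(I_j)`-orthogonal projection onto `ℙ^d(I_j)`.
(The family `Pc` realizes the global projections `P^d` onto `V^d`.) -/
def IsCellProj (pt : Fin (N+1) → ℝ)
    (Pc : Fin N → ℕ → Polynomial ℝ → Polynomial ℝ) : Prop :=
  ∀ (j : Fin N) (dd : ℕ) (p : Polynomial ℝ), (Pc j dd p).natDegree ≤ dd ∧
    ∀ q : Polynomial ℝ, q.natDegree ≤ dd → cip pt j (p - Pc j dd p) q = 0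

/-- `w` solves the damping initial value problem with initial data `u`:
`d/dt̂ ∫_{I_j} u_σ v dx + ∑_{m=0}^k (β_j σ_j^m(u)/h_j) ∫_{I_j} (u_σ - P^{m-1} u_σ) v dx = 0`
for every `v ∈ ℙ^k(I_j)` and every `j`, with `u_σ(·,0) = u`.  (Note `m - 1` is
truncated ℕ-subtraction, which realizes the convention `P^{-1} = P^0`.) -/
def IsDampingSol [NeZero N] (k : ℕ) (pt : Fin (N+1) → ℝ) (β : Fin N → ℝ)
    (Pc : Fin N → ℕ → Polynomial ℝ → Polynomial ℝ)
    (u : Fin N → Polynomial ℝ) (w : ℝ → Fin N → Polynomial ℝ) : Prop :=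
  w 0 = u ∧ (∀ t j, (w t j).natDegree ≤ k) ∧
  ∀ (t : ℝ) (j : Fin N) (v : Polynomial ℝ), v.natDegree ≤ k →
    HasDerivAt (fun s => cip pt j (w s j) v)
      (-(∑ m ∈ Finset.range (k+1),
        dampRate k pt β u m j * cip pt j (w t j - Pc j (m-1) (w t j)) v)) t

/-- `Fτ` is the OE (oscillation-eliminating) operator: for every `u ∈ V^k` the damping
initial value problem has a solution `w` and `Fτ u = w τ`. -/
def IsOEOp [NeZero N] (k : ℕ) (pt : Fin (N+1) → ℝ) (β : Fin N → ℝ)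
    (Pc : Fin N → ℕ → Polynomial ℝ → Polynomial ℝ) (τ : ℝ)
    (Fτ : (Fin N → Polynomial ℝ) → (Fin N → Polynomial ℝ)) : Prop :=
  ∀ u, MemVk k u → ∃ w, IsDampingSol k pt β Pc u w ∧ Fτ u = w τ

/-- Right-hand side of the weak form of the upwind DG operator for `u_t + β u_x = 0`:
`β ∫_{I_j} w v_x dx - β w(x_{j+1/2}^-) v(x_{j+1/2}^-) + β w(x_{j-1/2}^-) v(x_{j-1/2}^+)`. -/
noncomputable def dgRHS [NeZero N] (pt : Fin (N+1) → ℝ) (β : ℝ)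
    (w : Fin N → Polynomial ℝ) (j : Fin N) (v : Polynomial ℝ) : ℝ :=
  β * (∫ x in (ptL pt j)..(ptR pt j), (w j).eval x * (Polynomial.derivative v).eval x)
  - β * (w j).eval (ptR pt j) * v.eval (ptR pt j)
  + β * (w (j-1)).eval (pt (j-1).succ) * v.eval (ptL pt j)

/-- `L` is the upwind DG spatial operator on `V^k`. -/
def IsDGOp [NeZero N] (k : ℕ) (pt : Fin (N+1) → ℝ) (β : ℝ)
    (L : (Fin N → Polynomial ℝ) → (Fin N → Polynomial ℝ)) : Prop :=
  ∀ w, MemVk k w → MemVk k (L w) ∧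
    ∀ (j : Fin N) (v : Polynomial ℝ), v.natDegree ≤ k →
      cip pt j (L w j) v = dgRHS pt β w j v

/-- The upwind DG bilinear form
`H(w,v) = β ∑_j ∫_{I_j} w v_x dx + β ∑_j w(x_{j+1/2}^-) [v]_{j+1/2}`. -/
noncomputable def Hform [NeZero N] (pt : Fin (N+1) → ℝ) (β : ℝ)
    (w v : Fin N → Polynomial ℝ) : ℝ :=
  β * ∑ j : Fin N, (∫ x in (ptL pt j)..(ptR pt j),
      (w j).eval x * (Polynomial.derivative (v j)).eval x)
  + β * ∑ j : Fin N, (w j).eval (ptR pt j) * jumpD pt v 0 j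

/-- The upwind DG bilinear form with piecewise-smooth first argument. -/
noncomputable def HformF [NeZero N] (pt : Fin (N+1) → ℝ) (β : ℝ)
    (w : Fin N → ℝ → ℝ) (v : Fin N → Polynomial ℝ) : ℝ :=
  β * ∑ j : Fin N, (∫ x in (ptL pt j)..(ptR pt j),
      w j x * (Polynomial.derivative (v j)).eval x)
  + β * ∑ j : Fin N, w j (ptR pt j) * jumpD pt v 0 j

/-- `L²(Ω)` pairing of a piecewise-smooth function with a piecewise polynomial. -/
noncomputable def ipF (pt : Fin (N+1) → ℝ) (w : Fin N → ℝ → ℝ)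
    (v : Fin N → Polynomial ℝ) : ℝ :=
  ∑ j : Fin N, ∫ x in (ptL pt j)..(ptR pt j), w j x * (v j).eval x

/-- One Runge–Kutta stage: `∑_{0≤m≤ℓ} (c_{ℓm} u_σ^{n,m} + τ d_{ℓm} L(u_σ^{n,m}))`. -/
noncomputable def rkStage [NeZero N] (c d : ℕ → ℕ → ℝ) (τ : ℝ)
    (L : (Fin N → Polynomial ℝ) → (Fin N → Polynomial ℝ))
    (uσ : ℕ → Fin N → Polynomial ℝ) (ℓ : ℕ) : Fin N → Polynomial ℝ :=
  fun j => ∑ m ∈ Finset.range (ℓ+1),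
    (Polynomial.C (c ℓ m) * uσ m j + Polynomial.C (τ * d ℓ m) * L (uσ m) j)

/-- One full OEDG time step from `u_σ^n = un`: the stages `u_h^{n,ℓ+1}` and
`u_σ^{n,ℓ+1} = F_τ u_h^{n,ℓ+1}`, `0 ≤ ℓ ≤ s-1`. -/
def IsOEDGStep [NeZero N] (s : ℕ) (c d : ℕ → ℕ → ℝ) (τ : ℝ)
    (L Fτ : (Fin N → Polynomial ℝ) → (Fin N → Polynomial ℝ))
    (un : Fin N → Polynomial ℝ) (uh uσ : ℕ → Fin N → Polynomial ℝ) : Prop :=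
  uσ 0 = un ∧ ∀ ℓ < s, uh (ℓ+1) = rkStage c d τ L uσ ℓ ∧ uσ (ℓ+1) = Fτ (uh (ℓ+1))

/-- The full OEDG evolution: `uσ n ℓ = u_σ^{n,ℓ}` and `uh n ℓ = u_h^{n,ℓ}`, starting from
`u_σ^0 = u0`, with `u_σ^{n+1} = u_σ^{n,s}`. -/
def IsOEDGEvol [NeZero N] (s : ℕ) (c d : ℕ → ℕ → ℝ) (τ : ℝ)
    (L Fτ : (Fin N → Polynomial ℝ) → (Fin N → Polynomial ℝ))
    (u0 : Fin N → Polynomial ℝ) (uh uσ : ℕ → ℕ → Fin N → Polynomial ℝ) : Prop :=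
  uσ 0 0 = u0 ∧ ∀ n, uσ (n+1) 0 = uσ n s ∧
    ∀ ℓ < s, uh n (ℓ+1) = rkStage c d τ L (uσ n) ℓ ∧ uσ n (ℓ+1) = Fτ (uh n (ℓ+1))

/-- `p` is the Gauss–Radau projection of `w` on `[a,b]` into `ℙ^k`:
`∫_a^b (w - p) q dx = 0` for all `q ∈ ℙ^{k-1}` and `p(b) = w(b)`. -/
def IsGRProj (k : ℕ) (a b : ℝ) (w : ℝ → ℝ) (p : Polynomial ℝ) : Prop :=
  p.natDegree ≤ k ∧
  (∀ q : Polynomial ℝ, q.natDegree < k →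
    (∫ x in a..b, (w x - p.eval x) * q.eval x) = 0) ∧
  p.eval b = w b

/-- `u = u(x,t)` is a smooth `1`-periodic exact solution of `u_t + β u_x = 0`. -/
def IsSmoothSolution (β : ℝ) (u : ℝ → ℝ → ℝ) : Prop :=
  ContDiff ℝ (⊤ : ℕ∞) (fun p : ℝ × ℝ => u p.1 p.2) ∧
  (∀ x t, u (x+1) t = u x t) ∧
  (∀ x t, deriv (fun s => u x s) t + β * deriv (fun y => u y t) x = 0)

/-- Auxiliary table for the reference functions `U^{n,ℓ}`. -/
noncomputable def UrefUpTo (u : ℝ → ℝ → ℝ) (c d : ℕ → ℕ → ℝ) (β τ : ℝ) (n : ℕ) :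
    ℕ → ℕ → ℝ → ℝ
  | 0 => fun _ => fun x => u x ((n:ℝ) * τ)
  | (ℓ+1) => fun i =>
      if i ≤ ℓ then UrefUpTo u c d β τ n ℓ i
      else fun x => ∑ m ∈ Finset.range (ℓ+1),
        (c ℓ m * UrefUpTo u c d β τ n ℓ m x
          - τ * d ℓ m * β * deriv (UrefUpTo u c d β τ n ℓ m) x)

/-- Reference function `U^{n,ℓ}` (for `0 ≤ ℓ ≤ s-1`): `U^{n,0} = u(·, t^n)` and
`U^{n,ℓ+1} = ∑_{0≤m≤ℓ} (c_{ℓm} U^{n,m} - τ d_{ℓm} β ∂_x U^{n,m})`. -/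
noncomputable def Uref (u : ℝ → ℝ → ℝ) (c d : ℕ → ℕ → ℝ) (β τ : ℝ) (n ℓ : ℕ) : ℝ → ℝ :=
  UrefUpTo u c d β τ n ℓ ℓ

/-- Reference function `U^{n,ℓ}` including the final stage `U^{n,s} := u(·, t^{n+1})`. -/
noncomputable def UrefS (u : ℝ → ℝ → ℝ) (c d : ℕ → ℕ → ℝ) (β τ : ℝ) (s n ℓ : ℕ) : ℝ → ℝ :=
  if ℓ = s then fun x => u x (((n:ℝ)+1) * τ) else Uref u c d β τ n ℓ

/-- The Runge–Kutta residual `ρ^{n,s-1}`, defined so that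
`U^{n,s} = ∑_{0≤m≤s-1} (c_{s-1,m} U^{n,m} - τ d_{s-1,m} β ∂_x U^{n,m}) + τ ρ^{n,s-1}`. -/
noncomputable def rkRes (u : ℝ → ℝ → ℝ) (c d : ℕ → ℕ → ℝ) (β τ : ℝ) (s n : ℕ) : ℝ → ℝ :=
  fun x => (u x (((n:ℝ)+1) * τ) - ∑ m ∈ Finset.range s,
    (c (s-1) m * Uref u c d β τ n m x
      - τ * d (s-1) m * β * deriv (Uref u c d β τ n m) x)) / τ

/-- `L²(0,1)` norm of a function. -/
noncomputable def fl2 (f : ℝ → ℝ) : ℝ := Real.sqrt (∫ x in (0:ℝ)..1, (f x)^2)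

/-- `L²(Ω)` distance between a piecewise polynomial and a function. -/
noncomputable def errL2 (pt : Fin (N+1) → ℝ) (w : Fin N → Polynomial ℝ) (f : ℝ → ℝ) : ℝ :=
  Real.sqrt (∑ j : Fin N, ∫ x in (ptL pt j)..(ptR pt j), ((w j).eval x - f x)^2)


/-- If `s ↦ B (w s) v` has derivative `B w' v` for every `v`, where `B` is a nondegenerate symmetric
form on a finite-dimensional space, then `s ↦ B (w s) (w s)` has derivative `2 B w' (w t)`. -/
theorem hasDerivAt_bilinForm_self {V : Type*} [AddCommGroup V] [Module ℝ V]
    [FiniteDimensional ℝ V] (B : LinearMap.BilinForm ℝ V) (hB : B.Nondegenerate)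
    (hsymm : B.IsSymm) (w : ℝ → V) (w' : V) (t : ℝ)
    (h : ∀ v, HasDerivAt (fun s => B (w s) v) (B w' v) t) :
    HasDerivAt (fun s => B (w s) (w s)) (2 * B w' (w t)) t := by
  let b := Module.finBasis ℝ V
  let d := B.dualBasis hB b
  have hexp : ∀ x y, B x y = ∑ i, B x (b i) * B y (d i) := fun x y => by
    conv_lhs => rw [← d.sum_repr x]
    simp only [map_sum, map_smul, LinearMap.sum_apply, LinearMap.smul_apply, smul_eq_mul]
    refine Finset.sum_congr rfl fun i _ => ?_
    rw [LinearMap.BilinForm.dualBasis_repr_apply, hsymm.eq y (d i)]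
  have hsum := HasDerivAt.fun_sum (u := Finset.univ)
    fun i _ => (h (b i)).fun_mul (h (d i))
  simp only [Finset.sum_add_distrib, ← hexp] at hsum
  rw [hsymm.eq (w t) w', ← two_mul] at hsum
  exact hsum

theorem ptL_lt_ptR {pt : Fin (N+1) → ℝ} (hpt : IsMesh pt) (j : Fin N) : ptL pt j < ptR pt j :=
  hpt.2.2 j.castSucc_lt_succ

theorem cellh_pos {pt : Fin (N+1) → ℝ} (hpt : IsMesh pt) (j : Fin N) : 0 < cellh pt j :=
  sub_pos.2 (ptL_lt_ptR hpt j)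

theorem cip_comm (pt : Fin (N+1) → ℝ) (j : Fin N) (p q : Polynomial ℝ) :
    cip pt j p q = cip pt j q p := by
  simp only [cip, mul_comm]

theorem cip_add_left (pt : Fin (N+1) → ℝ) (j : Fin N) (p p' q : Polynomial ℝ) :
    cip pt j (p + p') q = cip pt j p q + cip pt j p' q := by
  simp only [cip, eval_add, add_mul]
  exact intervalIntegral.integral_add (Continuous.intervalIntegrable (by fun_prop) _ _)
    (Continuous.intervalIntegrable (by fun_prop) _ _)

theorem cip_smul_left (pt : Fin (N+1) → ℝ) (j : Fin N) (c : ℝ) (p q : Polynomial ℝ) :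
    cip pt j (c • p) q = c * cip pt j p q := by
  simp only [cip, eval_smul, smul_eq_mul, mul_assoc]
  exact intervalIntegral.integral_const_mul _ _

/-- The cellwise `L²` inner product as a bilinear form on polynomials. -/
noncomputable def cipForm (pt : Fin (N+1) → ℝ) (j : Fin N) :
    LinearMap.BilinForm ℝ (Polynomial ℝ) :=
  LinearMap.mk₂ ℝ (cip pt j) (cip_add_left pt j) (cip_smul_left pt j)
    (fun p q q' => by simp only [cip_comm pt j p, cip_add_left])
    (fun c p q => by simp only [cip_comm pt j p, cip_smul_left, smul_eq_mul])

theorem cipForm_apply (pt : Fin (N+1) → ℝ) (j : Fin N) (p q : Polynomial ℝ) :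
    cipForm pt j p q = cip pt j p q := rfl

theorem cip_self_nonneg {pt : Fin (N+1) → ℝ} (hpt : IsMesh pt) (j : Fin N) (p : Polynomial ℝ) :
    0 ≤ cip pt j p p :=
  intervalIntegral.integral_nonneg (ptL_lt_ptR hpt j).le fun _ _ => mul_self_nonneg _

theorem eq_zero_of_cip_self_eq_zero {pt : Fin (N+1) → ℝ} (hpt : IsMesh pt) (j : Fin N)
    {p : Polynomial ℝ} (h : cip pt j p p = 0) : p = 0 := by
  by_contra hp
  have hex : ∃ c ∈ Set.Icc (ptL pt j) (ptR pt j), 0 < p.eval c * p.eval c := by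
    by_contra! hall
    refine hp (p.eq_zero_of_infinite_isRoot
      ((Set.Icc_infinite (ptL_lt_ptR hpt j)).mono fun x hx => ?_))
    exact mul_self_eq_zero.1 (le_antisymm (hall x hx) (mul_self_nonneg _))
  have hpos := intervalIntegral.integral_pos (ptL_lt_ptR hpt j)
    (f := fun x => p.eval x * p.eval x) (by fun_prop) (fun _ _ => mul_self_nonneg _) hex
  exact hpos.ne' h

theorem linfSub_nonneg (pt : Fin (N+1) → ℝ) (u : Fin N → Polynomial ℝ) (c : ℝ) :
    0 ≤ linfSub pt u c := by
  refine Real.iSup_nonneg fun j => Real.sSup_nonneg ?_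
  rintro _ ⟨x, -, rfl⟩
  exact abs_nonneg _

theorem dampRate_nonneg [NeZero N] {k : ℕ} (hk : 1 ≤ k) {pt : Fin (N+1) → ℝ} (hpt : IsMesh pt)
    {β : Fin N → ℝ} (hβ : ∀ j, 0 ≤ β j) (u : Fin N → Polynomial ℝ) (m : ℕ) (j : Fin N) :
    0 ≤ dampRate k pt β u m j := by
  have hh := cellh_pos hpt j
  have hl := linfSub_nonneg pt u (avg pt u)
  have hk' : (0:ℝ) ≤ 2 * (k:ℝ) - 1 := by
    have : (1:ℝ) ≤ k := by exact_mod_cast hk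
    linarith
  have hσ : 0 ≤ sigma k pt u m j := by
    unfold sigma
    split_ifs
    · exact le_rfl
    · positivity
  exact div_nonneg (mul_nonneg (hβ j) hσ) hh.le

/-- Testing the projection residual with the function itself gives its squared norm. -/
theorem cip_sub_proj_self {pt : Fin (N+1) → ℝ} {Pc : Fin N → ℕ → Polynomial ℝ → Polynomial ℝ}
    (hPc : IsCellProj pt Pc) (j : Fin N) (d : ℕ) (p : Polynomial ℝ) :
    cip pt j (p - Pc j d p) p = cip pt j (p - Pc j d p) (p - Pc j d p) := by
  have h := (hPc j d p).2 _ (hPc j d p).1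
  rw [← cipForm_apply] at h
  rw [← cipForm_apply, ← cipForm_apply, (cipForm pt j (p - Pc j d p)).map_sub, h, sub_zero]

theorem dampRate_mul_cip_nonneg [NeZero N] {k : ℕ} {pt : Fin (N+1) → ℝ} (hpt : IsMesh pt)
    {β : Fin N → ℝ} (hβ : ∀ j, 0 ≤ β j) {Pc : Fin N → ℕ → Polynomial ℝ → Polynomial ℝ}
    (hPc : IsCellProj pt Pc) (u : Fin N → Polynomial ℝ) (m : ℕ) (j : Fin N)
    {p : Polynomial ℝ} (hp : p.natDegree ≤ k) :
    0 ≤ dampRate k pt β u m j * cip pt j (p - Pc j (m-1) p) p := by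
  rcases Nat.eq_zero_or_pos k with rfl | hk
  · rw [(hPc j (m-1) p).2 p (hp.trans (Nat.zero_le _)), mul_zero]
  · rw [cip_sub_proj_self hPc]
    exact mul_nonneg (dampRate_nonneg hk hpt hβ u m j) (cip_self_nonneg hpt j _)

theorem mem_degreeLT_succ {k : ℕ} {p : Polynomial ℝ} :
    p ∈ degreeLT ℝ (k+1) ↔ p.natDegree ≤ k := by
  rw [mem_degreeLT, degree_lt_iff_coeff_zero, natDegree_le_iff_coeff_eq_zero]
  rfl

/-- Energy identity for the damping problem. -/
theorem IsDampingSol.hasDerivAt_cip_self [NeZero N] {k : ℕ} {pt : Fin (N+1) → ℝ}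
    (hpt : IsMesh pt) {β : Fin N → ℝ} {Pc : Fin N → ℕ → Polynomial ℝ → Polynomial ℝ}
    (hPc : IsCellProj pt Pc) {u : Fin N → Polynomial ℝ} {w : ℝ → Fin N → Polynomial ℝ}
    (hw : IsDampingSol k pt β Pc u w) (j : Fin N) (t : ℝ) :
    HasDerivAt (fun s => cip pt j (w s j) (w s j))
      (2 * -(∑ m ∈ Finset.range (k+1),
        dampRate k pt β u m j * cip pt j (w t j - Pc j (m-1) (w t j)) (w t j))) t := by
  have hfin : FiniteDimensional ℝ (degreeLT ℝ (k+1)) :=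
    Module.Finite.equiv (degreeLTEquiv ℝ (k+1)).symm
  let B : LinearMap.BilinForm ℝ (degreeLT ℝ (k+1)) := (cipForm pt j).restrict (degreeLT ℝ (k+1))
  have hsymm : B.IsSymm := ⟨fun x y => cip_comm pt j x y⟩
  have hnd : B.Nondegenerate := by
    refine hsymm.isRefl.nondegenerate_iff_separatingLeft.2 fun x hx => ?_
    exact Subtype.ext (eq_zero_of_cip_self_eq_zero hpt j (hx x))
  let w' : Polynomial ℝ := -∑ m ∈ Finset.range (k+1),
    dampRate k pt β u m j • (w t j - Pc j (m-1) (w t j))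
  have hmem : w' ∈ degreeLT ℝ (k+1) := by
    refine neg_mem (sum_mem fun m hm => Submodule.smul_mem _ _ (sub_mem ?_ ?_))
    · exact mem_degreeLT_succ.2 (hw.2.1 t j)
    · have := Finset.mem_range.1 hm
      exact mem_degreeLT_succ.2 ((hPc j (m-1) (w t j)).1.trans (by omega))
  have hform : ∀ v, cip pt j w' v = -(∑ m ∈ Finset.range (k+1),
      dampRate k pt β u m j * cip pt j (w t j - Pc j (m-1) (w t j)) v) := fun v => by
    simp only [← cipForm_apply, w', map_neg, map_sum, map_smul, LinearMap.neg_apply,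
      LinearMap.sum_apply, LinearMap.smul_apply, smul_eq_mul]
  rw [← hform]
  refine hasDerivAt_bilinForm_self B hnd hsymm
    (fun s => ⟨w s j, mem_degreeLT_succ.2 (hw.2.1 s j)⟩) ⟨w', hmem⟩ t fun v => ?_
  change HasDerivAt (fun s => cip pt j (w s j) v) (cip pt j w' v) t
  rw [hform]
  exact hw.2.2 t j v (mem_degreeLT_succ.1 v.2)

theorem IsDampingSol.cl2_antitone [NeZero N] {k : ℕ} {pt : Fin (N+1) → ℝ}
    (hpt : IsMesh pt) {β : Fin N → ℝ} (hβ : ∀ j, 0 ≤ β j)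
    {Pc : Fin N → ℕ → Polynomial ℝ → Polynomial ℝ}
    (hPc : IsCellProj pt Pc) {u : Fin N → Polynomial ℝ} {w : ℝ → Fin N → Polynomial ℝ}
    (hw : IsDampingSol k pt β Pc u w) (j : Fin N) :
    Antitone fun t => cl2 pt j (w t j) := by
  have hderiv := hw.hasDerivAt_cip_self hpt hPc j
  have hanti : Antitone fun t => cip pt j (w t j) (w t j) := by
    refine antitone_of_deriv_nonpos (fun t => (hderiv t).differentiableAt) fun t => ?_
    rw [(hderiv t).deriv]
    have := Finset.sum_nonneg fun m (_ : m ∈ Finset.range (k+1)) =>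
      dampRate_mul_cip_nonneg hpt hβ hPc u m j (hw.2.1 t j)
    linarith
  exact fun _ _ hst => Real.sqrt_le_sqrt (hanti hst)

/-- Cellwise `L²` stability of the OE procedure.  For every `u ∈ V^k`
and nonnegative wave speeds `β_j`, any solution of the damping IVP has nonincreasing
cellwise `L²` norms: `‖u_σ(·,t̂₂)‖_{L²(I_j)} ≤ ‖u_σ(·,t̂₁)‖_{L²(I_j)}` for
`0 ≤ t̂₁ ≤ t̂₂`; in particular `‖F_τ u‖_{L²(I_j)} ≤ ‖u‖_{L²(I_j)}` for every cell. -/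
theorem oe_l2_stability
    {N : ℕ} [NeZero N] (k : ℕ) (pt : Fin (N+1) → ℝ) (hpt : IsMesh pt)
    (β : Fin N → ℝ) (hβ : ∀ j, 0 ≤ β j)
    (Pc : Fin N → ℕ → Polynomial ℝ → Polynomial ℝ) (hPc : IsCellProj pt Pc)
    (u : Fin N → Polynomial ℝ) (hu : MemVk k u) :
    (∀ w : ℝ → Fin N → Polynomial ℝ, IsDampingSol k pt β Pc u w →
      ∀ j : Fin N, ∀ t₁ t₂ : ℝ, 0 ≤ t₁ → t₁ ≤ t₂ →
        cl2 pt j (w t₂ j) ≤ cl2 pt j (w t₁ j)) ∧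
    (∀ τ : ℝ, 0 ≤ τ →
      ∀ Fτ : (Fin N → Polynomial ℝ) → (Fin N → Polynomial ℝ), IsOEOp k pt β Pc τ Fτ →
      ∀ j : Fin N, cl2 pt j (Fτ u j) ≤ cl2 pt j (u j)) := by
  refine ⟨fun w hw j t₁ t₂ _ h₁₂ => hw.cl2_antitone hpt hβ hPc j h₁₂, fun τ hτ Fτ hF j => ?_⟩
  obtain ⟨w, hw, hFw⟩ := hF u hu
  have h := hw.cl2_antitone hpt hβ hPc j hτ
  rw [hFw]
  simpa only [hw.1] using h
end OEDG
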